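/- (Splitting lemma for RH_1.) Fix Q_1 > Q > 0 and let Ω_{Q_1} = {(x,y) ∈ ℝ² : x > 0 and x·log x ≤ y ≤ x·log x + Q_1·x}. There exists α ∈ (0, 1/2], depending only on Q and Q_1, such that for every weight w on ℝ with w·log w locally integrable and [w]_{RH_1} < Q, and every bounded interval I of positive length, I can be split into two adjacent subintervals I⁻ and I⁺ with I = I⁻ ∪ I⁺, α ≤ |I⁻|/|I| ≤ 1 − α, such that the closed line segment joining x⁻ = (⟨w⟩_{I⁻}, ⟨w·log w⟩_{I⁻}) and x⁺ = (⟨w⟩_{I⁺}, ⟨w·log w⟩_{I⁺}) is contained in Ω_{Q_1}. -/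

import Mathlib

open MeasureTheory Real

/-- The average `⟨f⟩_{(a,b)} = (b-a)⁻¹ ∫_a^b f` of a function over a bounded interval. -/
noncomputable def intAvg (f : ℝ → ℝ) (a b : ℝ) : ℝ := (b - a)⁻¹ * ∫ t in a..b, f t

/-- The domain `Ω_Q = {(x, y) : x > 0, x log x ≤ y ≤ x log x + Q x}`. -/
def entropyDomain (Q : ℝ) : Set (ℝ × ℝ) :=
  {z : ℝ × ℝ | 0 < z.1 ∧ z.1 * Real.log z.1 ≤ z.2 ∧
    z.2 ≤ z.1 * Real.log z.1 + Q * z.1}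

lemma mul_log_add_sub_le_mul_log {x p : ℝ} (hx : 0 < x) (hp : 0 < p) :
    x * log p + x - p ≤ x * log x := by
  have h := log_le_sub_one_of_pos (div_pos hp hx)
  rw [log_div hp.ne' hx.ne'] at h
  have h2 := mul_le_mul_of_nonneg_left h hx.le
  have h3 : x * (p / x - 1) = p - x := by field_simp
  linarith

/-- The set above the graph of `x log x`, over the positive half-line, is convex. -/
lemma convex_epigraph_mul_log : Convex ℝ {z : ℝ × ℝ | 0 < z.1 ∧ z.1 * log z.1 ≤ z.2} := by
  exact (convexOn_mul_log.subset Set.Ioi_subset_Ici_self (convex_Ioi 0)).convex_epigraph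

/-- If the tangent line to `x log x + Q₁ x` at `p` passes through a point of `Ω_Q` whose abscissa
is at least `p`, then this abscissa is at least `(1 + (Q₁ - Q)) p`. -/
lemma one_add_mul_le_of_mem_tangent {Q Q1 p : ℝ} (hp : 0 < p) {z : ℝ × ℝ}
    (hz : z ∈ entropyDomain Q) (hline : z.2 = z.1 * (log p + 1 + Q1) - p) (hpz : p ≤ z.1) :
    (1 + (Q1 - Q)) * p ≤ z.1 := by
  obtain ⟨h0, -, h2⟩ := hz
  have h3 : z.1 * (Q1 - Q) ≤ z.1 * (log z.1 - log p) := by nlinarith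
  have h4 := le_of_mul_le_mul_left h3 h0
  have h5 := log_le_sub_one_of_pos (div_pos h0 hp)
  rw [log_div h0.ne' hp.ne'] at h5
  have h6 : 1 + (Q1 - Q) ≤ z.1 / p := by linarith
  exact (le_div_iff₀ hp).1 h6

/-- If the tangent line to `x log x + Q₁ x` at `p` passes through a point above the graph of
`x log x`, then the abscissa of this point is at most `exp (Q₁ + 1) p`. -/
lemma le_exp_mul_of_mem_tangent {Q Q1 p : ℝ} (hp : 0 < p) {z : ℝ × ℝ}
    (hz : z ∈ entropyDomain Q) (hline : z.2 = z.1 * (log p + 1 + Q1) - p) :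
    z.1 ≤ exp (Q1 + 1) * p := by
  obtain ⟨h0, h1, -⟩ := hz
  have h3 : z.1 * log z.1 ≤ z.1 * (log p + 1 + Q1) := by nlinarith
  have h4 := le_of_mul_le_mul_left h3 h0
  rw [← log_le_log_iff h0 (by positivity), log_mul (exp_pos _).ne' hp.ne', log_exp]
  linarith

/-- A segment lying below the graph of `x log x + Q₁ x` and meeting it at an interior point is
contained in the tangent line at that point. -/
lemma mem_tangent_of_touch {Q1 s : ℝ} {P R : ℝ × ℝ} (hP : 0 < P.1) (hR : 0 < R.1)
    (hs : s ∈ Set.Ioo (0 : ℝ) 1)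
    (hle : ∀ t ∈ Set.Icc (0 : ℝ) 1, P.2 + t * (R.2 - P.2) ≤
      (P.1 + t * (R.1 - P.1)) * log (P.1 + t * (R.1 - P.1)) + Q1 * (P.1 + t * (R.1 - P.1)))
    (heq : (P.1 + s * (R.1 - P.1)) * log (P.1 + s * (R.1 - P.1)) + Q1 * (P.1 + s * (R.1 - P.1)) ≤
      P.2 + s * (R.2 - P.2)) (t : ℝ) :
    P.2 + t * (R.2 - P.2) = (P.1 + t * (R.1 - P.1)) * (log (P.1 + s * (R.1 - P.1)) + 1 + Q1) -
      (P.1 + s * (R.1 - P.1)) := by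
  have hp : 0 < P.1 + s * (R.1 - P.1) := by
    have := hs.1; have := hs.2; nlinarith [mul_pos hs.1 hR, mul_pos (sub_pos.2 hs.2) hP]
  have hX : HasDerivAt (fun t : ℝ => P.1 + t * (R.1 - P.1)) (R.1 - P.1) s := by
    simpa using ((hasDerivAt_id s).mul_const (R.1 - P.1)).const_add P.1
  have hY : HasDerivAt (fun t : ℝ => P.2 + t * (R.2 - P.2)) (R.2 - P.2) s := by
    simpa using ((hasDerivAt_id s).mul_const (R.2 - P.2)).const_add P.2
  have hG := (((hasDerivAt_mul_log hp.ne').comp s hX).add (hX.const_mul Q1)).sub hY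
  have hmin : IsLocalMin ((((fun x => x * log x) ∘ fun t : ℝ => P.1 + t * (R.1 - P.1)) +
      fun t : ℝ => Q1 * (P.1 + t * (R.1 - P.1))) - fun t : ℝ => P.2 + t * (R.2 - P.2)) s := by
    filter_upwards [Icc_mem_nhds hs.1 hs.2] with t ht
    have := hle t ht
    simp only [Pi.sub_apply, Pi.add_apply, Function.comp_apply]
    linarith
  have hd := hmin.hasDerivAt_eq_zero hG
  have hval := le_antisymm (hle s ⟨hs.1.le, hs.2.le⟩) heq
  linear_combination hval + (s - t) * hd

/-- A segment of a tangent line to `x log x + Q₁ x` with endpoints above the graph of `x log x`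
is contained in `Ω_{Q₁}`. -/
lemma segment_subset_of_mem_tangent {Q Q1 p : ℝ} (hp : 0 < p) {S R : ℝ × ℝ}
    (hS : S ∈ entropyDomain Q) (hR : R ∈ entropyDomain Q)
    (hSl : S.2 = S.1 * (log p + 1 + Q1) - p) (hRl : R.2 = R.1 * (log p + 1 + Q1) - p) :
    segment ℝ S R ⊆ entropyDomain Q1 := by
  intro z hz
  obtain ⟨h0, h1⟩ := convex_epigraph_mul_log.segment_subset (x := S) (y := R)
    ⟨hS.1, hS.2.1⟩ ⟨hR.1, hR.2.1⟩ hz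
  refine ⟨h0, h1, ?_⟩
  have hzl : z.2 = z.1 * (log p + 1 + Q1) - p := by
    obtain ⟨u, v, -, -, huv, rfl⟩ := hz
    simp only [Prod.fst_add, Prod.snd_add, Prod.smul_fst, Prod.smul_snd, smul_eq_mul]
    linear_combination u * hSl + v * hRl - p * huv
  have := mul_log_add_sub_le_mul_log h0 hp
  linarith

/-- If an endpoint of the splitting moves continuously towards `P`, starting from a position where
the segment joining it to `P` leaves `Ω_{Q₁}`, then at some quantitatively controlled time the
segment joining both endpoints lies in `Ω_{Q₁}`. -/
lemma exists_segment_subset_of_path {Q Q1 : ℝ} (hQQ1 : Q < Q1) {P : ℝ × ℝ} {R S : ℝ → ℝ × ℝ}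
    (hRc : ContinuousOn R (Set.Icc 0 (1 / 2))) (hR0 : R 0 = P) (hP : P ∈ entropyDomain Q)
    (hR : ∀ l ∈ Set.Ioc (0 : ℝ) (1 / 2), R l ∈ entropyDomain Q)
    (hS : ∀ l ∈ Set.Ioc (0 : ℝ) (1 / 2), S l ∈ entropyDomain Q)
    (hPRS : ∀ l ∈ Set.Ioc (0 : ℝ) (1 / 2), P = l • S l + (1 - l) • R l)
    (hbad : ∃ z ∈ segment ℝ P (R (1 / 2)), z.1 * log z.1 + Q1 * z.1 ≤ z.2) :
    ∃ l ∈ Set.Icc ((Q1 - Q) / exp (Q1 + 1)) (1 / 2),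
      segment ℝ (S l) (R l) ⊆ entropyDomain Q1 := by
  set X : ℝ × ℝ → ℝ := fun q => P.1 + q.2 * ((R q.1).1 - P.1) with hX
  set G : ℝ × ℝ → ℝ := fun q => X q * log (X q) + Q1 * X q -
    (P.2 + q.2 * ((R q.1).2 - P.2)) with hG
  set D : Set (ℝ × ℝ) := Set.Icc 0 (1 / 2) ×ˢ Set.Icc 0 1 with hD
  have hgap : ∀ z ∈ entropyDomain Q, z.2 < z.1 * log z.1 + Q1 * z.1 := by
    rintro z ⟨h0, -, h2⟩
    nlinarith [mul_lt_mul_of_pos_right hQQ1 h0]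
  have hRD : ContinuousOn (fun q : ℝ × ℝ => R q.1) D :=
    hRc.comp continuousOn_fst fun q hq => hq.1
  have hXc : ContinuousOn X D := by
    have := hRD.fst
    fun_prop
  have hGc : ContinuousOn G D := by
    have h1 := continuous_mul_log.comp_continuousOn hXc
    have h2 := hRD.snd
    exact (h1.add (hXc.const_mul Q1)).sub (by fun_prop)
  have hKc : IsCompact (D ∩ G ⁻¹' Set.Iic 0) :=
    (isCompact_Icc.prod isCompact_Icc).of_isClosed_subset
      (hGc.preimage_isClosed_of_isClosed (isClosed_Icc.prod isClosed_Icc) isClosed_Iic)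
      Set.inter_subset_left
  have hKn : (D ∩ G ⁻¹' Set.Iic 0).Nonempty := by
    obtain ⟨z, hz, hz2⟩ := hbad
    rw [segment_eq_image'] at hz
    obtain ⟨s, hs, rfl⟩ := hz
    refine ⟨(1 / 2, s), ⟨by norm_num, hs⟩, ?_⟩
    simpa [hG, hX] using hz2
  obtain ⟨⟨l, s⟩, ⟨⟨hl, hs⟩, hGl⟩, hmin⟩ := hKc.exists_isMinOn hKn continuousOn_fst
  simp only [Set.mem_preimage, Set.mem_Iic] at hGl hl hs
  have hG0 : ∀ t, 0 < G (0, t) := by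
    intro t
    have := hgap P hP
    simp only [hG, hX, hR0, sub_self, mul_zero, add_zero]
    linarith
  have hl0 : 0 < l := by
    rcases hl.1.eq_or_lt with h | h
    · subst h
      exact absurd (hG0 s) hGl.not_gt
    · exact h
  have hlI : l ∈ Set.Ioc (0 : ℝ) (1 / 2) := ⟨hl0, hl.2⟩
  have hGnn : ∀ t ∈ Set.Icc (0 : ℝ) 1, 0 ≤ G (l, t) := by
    intro t ht
    by_contra! hneg
    have hc : ContinuousOn (fun k => G (k, t)) (Set.Icc 0 l) :=
      hGc.comp (by fun_prop) fun k hk => ⟨⟨hk.1, hk.2.trans hl.2⟩, ht⟩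
    obtain ⟨k, hk, hk0⟩ := intermediate_value_Icc' hl0.le hc ⟨hneg.le, (hG0 t).le⟩
    have hlk : l ≤ k := hmin ⟨⟨⟨hk.1, hk.2.trans hl.2⟩, ht⟩, hk0.le⟩
    obtain rfl := le_antisymm hlk hk.2
    exact hneg.ne hk0
  have hRl := hR l hlI
  have hSl := hS l hlI
  have hs' : s ∈ Set.Ioo (0 : ℝ) 1 := by
    refine ⟨hs.1.lt_of_ne ?_, hs.2.lt_of_ne ?_⟩
    · rintro rfl
      have := hgap P hP
      simp only [hG, hX, zero_mul, add_zero] at hGl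
      linarith
    · rintro rfl
      have := hgap _ hRl
      simp only [hG, hX, one_mul, add_sub_cancel] at hGl
      linarith
  have htan := mem_tangent_of_touch (Q1 := Q1) hP.1 hRl.1 hs'
    (fun t ht => sub_nonneg.1 (hGnn t ht)) (sub_nonpos.1 hGl)
  set p := P.1 + s * ((R l).1 - P.1) with hp_def
  have hp : 0 < p := by
    nlinarith [mul_pos hs'.1 hRl.1, mul_pos (sub_pos.2 hs'.2) hP.1]
  have hPt : P.2 = P.1 * (log p + 1 + Q1) - p := by simpa using htan 0
  have hRt : (R l).2 = (R l).1 * (log p + 1 + Q1) - p := by simpa using htan 1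
  have hc1 : P.1 = l * (S l).1 + (1 - l) * (R l).1 := by
    simpa using congrArg Prod.fst (hPRS l hlI)
  have hc2 : P.2 = l * (S l).2 + (1 - l) * (R l).2 := by
    simpa using congrArg Prod.snd (hPRS l hlI)
  have hSt : (S l).2 = (S l).1 * (log p + 1 + Q1) - p := by
    apply mul_left_cancel₀ hl0.ne'
    linear_combination hPt - (1 - l) * hRt - hc2 + (log p + 1 + Q1) * hc1
  refine ⟨l, ⟨?_, hl.2⟩, segment_subset_of_mem_tangent hp hSl hRl hSt hRt⟩
  have hSM := le_exp_mul_of_mem_tangent hp hSl hSt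
  have hRM := le_exp_mul_of_mem_tangent hp hRl hRt
  rw [div_le_iff₀ (exp_pos _)]
  refine le_of_mul_le_mul_right ?_ hp
  rcases le_total P.1 (R l).1 with h | h
  · have h1 := one_add_mul_le_of_mem_tangent hp hRl hRt
      (by nlinarith [mul_nonneg (sub_nonneg.2 hs.2) (sub_nonneg.2 h)])
    have h2 : P.1 ≤ p := by nlinarith [mul_nonneg hs.1 (sub_nonneg.2 h)]
    nlinarith [mul_le_mul_of_nonneg_left hRM hl0.le, mul_pos hl0 hSl.1]
  · have h1 := one_add_mul_le_of_mem_tangent hp hP hPt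
      (by nlinarith [mul_nonneg hs.1 (sub_nonneg.2 h)])
    have h2 : (R l).1 ≤ p := by nlinarith [mul_nonneg (sub_nonneg.2 hs.2) (sub_nonneg.2 h)]
    nlinarith [mul_le_mul_of_nonneg_left hSM hl0.le, mul_pos hl0 hRl.1]

lemma intAvg_eq_combination {f : ℝ → ℝ} (hf : LocallyIntegrable f) {a b c : ℝ}
    (hac : a < c) (hcb : c < b) :
    intAvg f a b = (c - a) / (b - a) * intAvg f a c + (b - c) / (b - a) * intAvg f c b := by
  have hi : ∀ u v : ℝ, IntervalIntegrable f volume u v := fun u v =>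
    (hf.integrableOn_isCompact isCompact_uIcc).intervalIntegrable
  have h1 : c - a ≠ 0 := (sub_pos.2 hac).ne'
  have h2 : b - c ≠ 0 := (sub_pos.2 hcb).ne'
  have h3 : b - a ≠ 0 := (sub_pos.2 (hac.trans hcb)).ne'
  unfold intAvg
  rw [← intervalIntegral.integral_add_adjacent_intervals (hi a c) (hi c b)]
  field_simp

lemma continuousOn_intAvg_right {f : ℝ → ℝ} (hf : LocallyIntegrable f) (a : ℝ) :
    ContinuousOn (fun c => intAvg f a c) (Set.Ioi a) := by
  have hi : ∀ u v : ℝ, IntervalIntegrable f volume u v := fun u v =>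
    (hf.integrableOn_isCompact isCompact_uIcc).intervalIntegrable
  refine ContinuousOn.mul (ContinuousOn.inv₀ (by fun_prop) fun c hc => (sub_pos.2 hc).ne') ?_
  exact (intervalIntegral.continuous_primitive hi a).continuousOn

lemma intAvg_symm (f : ℝ → ℝ) (a b : ℝ) : intAvg f a b = intAvg f b a := by
  unfold intAvg
  rw [intervalIntegral.integral_symm, ← neg_sub a b, inv_neg, neg_mul_neg]

lemma continuousOn_intAvg_left {f : ℝ → ℝ} (hf : LocallyIntegrable f) (b : ℝ) :
    ContinuousOn (fun c => intAvg f c b) (Set.Iio b) := by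
  have hi : ∀ u v : ℝ, IntervalIntegrable f volume u v := fun u v =>
    (hf.integrableOn_isCompact isCompact_uIcc).intervalIntegrable
  simp_rw [fun c => intAvg_symm f c b]
  refine ContinuousOn.mul (ContinuousOn.inv₀ (by fun_prop) fun c hc => (sub_neg.2 hc).ne) ?_
  exact (intervalIntegral.continuous_primitive hi b).continuousOn

lemma intAvg_pos {w : ℝ → ℝ} (hw : LocallyIntegrable w) (hpos : ∀ᵐ t ∂volume, 0 < w t)
    {a b : ℝ} (hab : a < b) : 0 < intAvg w a b := by
  refine mul_pos (inv_pos.2 (sub_pos.2 hab)) ?_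
  have hi : IntervalIntegrable w volume a b :=
    (hw.integrableOn_isCompact isCompact_uIcc).intervalIntegrable
  rw [intervalIntegral.integral_of_le hab.le, setIntegral_pos_iff_support_of_nonneg_ae
    (ae_restrict_of_ae (hpos.mono fun t ht => ht.le)) hi.1]
  have : (Function.support w ∩ Set.Ioc a b : Set ℝ) =ᵐ[volume] Set.Ioc a b := by
    filter_upwards [hpos] with t ht
    apply propext
    exact ⟨fun h => h.2, fun h => ⟨ht.ne', h⟩⟩
  rw [measure_congr this]
  simpa using hab

/-- Jensen's inequality for `x log x` and averages over intervals. -/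
lemma intAvg_mul_log_le {w : ℝ → ℝ} (hw : LocallyIntegrable w) (hpos : ∀ᵐ t ∂volume, 0 < w t)
    (hwl : LocallyIntegrable (fun t => w t * log (w t))) {a b : ℝ} (hab : a < b) :
    intAvg w a b * log (intAvg w a b) ≤ intAvg (fun t => w t * log (w t)) a b := by
  have hm := intAvg_pos hw hpos hab
  set m := intAvg w a b with hm_def
  have hi : IntervalIntegrable w volume a b :=
    (hw.integrableOn_isCompact isCompact_uIcc).intervalIntegrable
  have hil : IntervalIntegrable (fun t => w t * log (w t)) volume a b :=
    (hwl.integrableOn_isCompact isCompact_uIcc).intervalIntegrable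
  have h := intervalIntegral.integral_mono_ae hab.le
    (((hi.mul_const (log m)).add hi).sub (intervalIntegrable_const (c := m))) hil
    (hpos.mono fun t ht => mul_log_add_sub_le_mul_log ht hm)
  rw [intervalIntegral.integral_sub ((hi.mul_const (log m)).add hi) intervalIntegrable_const,
    intervalIntegral.integral_add (hi.mul_const (log m)) hi, intervalIntegral.integral_mul_const,
    intervalIntegral.integral_const, smul_eq_mul] at h
  have hba := sub_pos.2 hab
  have hmi : ∫ t in a..b, w t = (b - a) * m := by
    rw [hm_def, intAvg, mul_inv_cancel_left₀ hba.ne']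
  rw [hmi] at h
  rw [intAvg, le_inv_mul_iff₀ hba]
  linarith

lemma segment_subset_union_midpoint {E : Type*} [AddCommGroup E] [Module ℝ E] {P S R : E}
    (hP : P = (1 / 2 : ℝ) • S + (1 / 2 : ℝ) • R) :
    segment ℝ S R ⊆ segment ℝ P S ∪ segment ℝ P R := by
  rintro z ⟨u, v, hu, hv, huv, rfl⟩
  obtain rfl : v = 1 - u := by linarith
  rcases le_total (1 / 2) u with h | h
  · refine Or.inl ⟨2 * (1 - u), 2 * u - 1, by linarith, by linarith, by ring, ?_⟩
    rw [hP]
    module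
  · refine Or.inr ⟨2 * u, 1 - 2 * u, by linarith, by linarith, by ring, ?_⟩
    rw [hP]
    module

/-- **Splitting lemma for `RH₁`.**
Fix `Q₁ > Q > 0` and let `Ω_{Q₁} = {(x,y) : x > 0, x·log x ≤ y ≤ x·log x + Q₁·x}`.
There is `α ∈ (0, 1/2]`, depending only on `Q` and `Q₁`, such that every bounded
interval `I = (a,b)` can be split at a point `c` into adjacent subintervals
`I⁻ = (a,c)`, `I⁺ = (c,b)` with `α ≤ |I⁻|/|I| ≤ 1 − α`, so that for every weight `w`
with `w·log w` locally integrable and `[w]_{RH₁} ≤ Q < Q₁`, the segment joining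
`x⁻ = (⟨w⟩_{I⁻}, ⟨w log w⟩_{I⁻})` and `x⁺ = (⟨w⟩_{I⁺}, ⟨w log w⟩_{I⁺})` lies in
`Ω_{Q₁}`. -/
theorem splitting_lemma_rh1 (Q Q1 : ℝ) (hQ : 0 < Q) (hQQ1 : Q < Q1) :
    ∃ α : ℝ, 0 < α ∧ α ≤ 1/2 ∧
      ∀ w : ℝ → ℝ, LocallyIntegrable w → (∀ᵐ t ∂volume, 0 < w t) →
        LocallyIntegrable (fun t => w t * Real.log (w t)) →
        (∀ a b : ℝ, a < b →
          intAvg (fun t => w t * Real.log (w t)) a b ≤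
            intAvg w a b * Real.log (intAvg w a b) + Q * intAvg w a b) →
        ∀ a b : ℝ, a < b →
          ∃ c : ℝ, a < c ∧ c < b ∧
            α ≤ (c - a)/(b - a) ∧ (c - a)/(b - a) ≤ 1 - α ∧
            segment ℝ (intAvg w a c, intAvg (fun t => w t * Real.log (w t)) a c)
                (intAvg w c b, intAvg (fun t => w t * Real.log (w t)) c b) ⊆
              {z : ℝ × ℝ | 0 < z.1 ∧ z.1 * Real.log z.1 ≤ z.2 ∧
                z.2 ≤ z.1 * Real.log z.1 + Q1 * z.1} := by
  have hδ : 0 < Q1 - Q := sub_pos.2 hQQ1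
  have hα : 0 < (Q1 - Q) / exp (Q1 + 1) := div_pos hδ (exp_pos _)
  have hα2 : (Q1 - Q) / exp (Q1 + 1) ≤ 1 / 2 := by
    rw [div_le_iff₀ (exp_pos _), exp_add]
    nlinarith [add_one_le_exp Q1, add_one_le_exp (1 : ℝ), exp_pos Q1]
  refine ⟨_, hα, hα2, fun w hw hpos hwl hQw a b hab => ?_⟩
  change ∃ c : ℝ, a < c ∧ c < b ∧ _ ∧ _ ∧ _ ⊆ entropyDomain Q1
  set A : ℝ → ℝ → ℝ × ℝ := fun u v => (intAvg w u v, intAvg (fun t => w t * log (w t)) u v)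
    with hA
  have hmem : ∀ u v, u < v → A u v ∈ entropyDomain Q := fun u v huv =>
    ⟨intAvg_pos hw hpos huv, intAvg_mul_log_le hw hpos hwl huv, hQw u v huv⟩
  have hba : 0 < b - a := sub_pos.2 hab
  have hcomb : ∀ c, a < c → c < b →
      A a b = ((c - a) / (b - a)) • A a c + ((b - c) / (b - a)) • A c b := fun c hac hcb =>
    Prod.ext (intAvg_eq_combination hw hac hcb) (intAvg_eq_combination hwl hac hcb)
  have hl : ∀ l ∈ Set.Ioc (0 : ℝ) (1 / 2), 0 < l * (b - a) ∧ l * (b - a) < b - a := fun l hl =>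
    ⟨mul_pos hl.1 hba, by nlinarith [hl.2]⟩
  have hratio : ∀ l, l * (b - a) / (b - a) = l := fun l => mul_div_cancel_right₀ l hba.ne'
  have hratio' : ∀ l, (b - a - l * (b - a)) / (b - a) = 1 - l := fun l => by
    rw [sub_div, hratio, div_self hba.ne']
  have hmid : b - 1 / 2 * (b - a) = a + 1 / 2 * (b - a) := by ring
  have hcombl : ∀ l ∈ Set.Ioc (0 : ℝ) (1 / 2), A a b =
      l • A a (a + l * (b - a)) + (1 - l) • A (a + l * (b - a)) b := fun l h => by
    obtain ⟨h1, h2⟩ := hl l h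
    convert hcomb (a + l * (b - a)) (by linarith) (by linarith) using 3
    · rw [add_sub_cancel_left, hratio]
    · rw [← sub_sub, hratio']
  have hcombr : ∀ l ∈ Set.Ioc (0 : ℝ) (1 / 2), A a b =
      l • A (b - l * (b - a)) b + (1 - l) • A a (b - l * (b - a)) := fun l h => by
    obtain ⟨h1, h2⟩ := hl l h
    rw [add_comm]
    convert hcomb (b - l * (b - a)) (by linarith) (by linarith) using 3
    · rw [sub_right_comm, hratio']
    · rw [sub_sub_cancel, hratio]
  have hhalf : (1 / 2 : ℝ) ∈ Set.Ioc (0 : ℝ) (1 / 2) := by norm_num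
  by_cases hbadr : ∃ z ∈ segment ℝ (A a b) (A (a + 1 / 2 * (b - a)) b),
      z.1 * log z.1 + Q1 * z.1 ≤ z.2
  · obtain ⟨l, hlα, hseg⟩ := exists_segment_subset_of_path hQQ1
      (R := fun l => A (a + l * (b - a)) b) (S := fun l => A a (a + l * (b - a)))
      (by
        have hmaps : Set.MapsTo (fun l => a + l * (b - a)) (Set.Icc 0 (1 / 2)) (Set.Iio b) :=
          fun l h => by simp only [Set.mem_Iio]; nlinarith [h.2]
        exact ((continuousOn_intAvg_left hw b).comp (by fun_prop) hmaps).prodMk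
          ((continuousOn_intAvg_left hwl b).comp (by fun_prop) hmaps))
      (by simp) (hmem a b hab)
      (fun l h => hmem _ _ (by linarith [(hl l h).2]))
      (fun l h => hmem _ _ (by linarith [(hl l h).1])) hcombl hbadr
    obtain ⟨h1, h2⟩ := hl l ⟨hα.trans_le hlα.1, hlα.2⟩
    refine ⟨a + l * (b - a), by linarith, by linarith, ?_, ?_, hseg⟩
    · rw [add_sub_cancel_left, hratio]
      exact hlα.1
    · rw [add_sub_cancel_left, hratio]
      linarith [hlα.2]
  by_cases hbadl : ∃ z ∈ segment ℝ (A a b) (A a (a + 1 / 2 * (b - a))),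
      z.1 * log z.1 + Q1 * z.1 ≤ z.2
  · obtain ⟨l, hlα, hseg⟩ := exists_segment_subset_of_path hQQ1
      (R := fun l => A a (b - l * (b - a))) (S := fun l => A (b - l * (b - a)) b)
      (by
        have hmaps : Set.MapsTo (fun l => b - l * (b - a)) (Set.Icc 0 (1 / 2)) (Set.Ioi a) :=
          fun l h => by simp only [Set.mem_Ioi]; nlinarith [h.2]
        exact ((continuousOn_intAvg_right hw a).comp (by fun_prop) hmaps).prodMk
          ((continuousOn_intAvg_right hwl a).comp (by fun_prop) hmaps))
      (by simp) (hmem a b hab)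
      (fun l h => hmem _ _ (by linarith [(hl l h).2]))
      (fun l h => hmem _ _ (by linarith [(hl l h).1])) hcombr (by rwa [hmid])
    obtain ⟨h1, h2⟩ := hl l ⟨hα.trans_le hlα.1, hlα.2⟩
    refine ⟨b - l * (b - a), by linarith, by linarith, ?_, ?_,
      (segment_symm ℝ _ _).trans_subset hseg⟩
    · rw [sub_right_comm, hratio']
      linarith [hlα.2]
    · rw [sub_right_comm, hratio']
      linarith [hlα.1]
  push Not at hbadr hbadl
  obtain ⟨h1, h2⟩ := hl _ hhalf
  refine ⟨a + 1 / 2 * (b - a), by linarith, by linarith, ?_, ?_, fun z hz => ?_⟩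
  · rwa [add_sub_cancel_left, hratio]
  · rw [add_sub_cancel_left, hratio]
    linarith
  have hz' := convex_epigraph_mul_log.segment_subset (x := A a (a + 1 / 2 * (b - a)))
    (y := A (a + 1 / 2 * (b - a)) b)
    ((hmem _ _ (by linarith)).imp_right And.left) ((hmem _ _ (by linarith)).imp_right And.left) hz
  refine ⟨hz'.1, hz'.2, ?_⟩
  have hP := hcombl _ hhalf
  rw [show (1 : ℝ) - 1 / 2 = 1 / 2 by norm_num] at hP
  rcases segment_subset_union_midpoint hP hz with h | h
  · exact (hbadl z h).le
  · exact (hbadr z h).le
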